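/- Exponential bound on the probability of k-badness. Let Γ, γ be moderately steep scales with parameters a > 0 and ε ∈ (0,1), let Q be a probability measure on {0,1}^{ℤ^d} satisfying the decay condition (smin) with constants b'', B'', assume p = sup_x Q(ω_x = 1) ≤ exp{−a/(1−ε)}, and assume condition (gag): 2·9^d·B''·θ_{k+1}^{2d}·exp{−b''Γ_{k+1}/20} ≤ exp{−a(1+ε)^{k+1}/(1−ε)} for all k ≥ 0. Then for every k ≥ 0, sup_{x∈ℤ^d} Q(ω : x ∈ B_k(ω)) ≤ exp{−(a/(1−ε))(1+ε)^k}, where B_k(ω) is the set of k-bad sites of the recursive classification of badness. -/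

import Mathlib

namespace Paper

open MeasureTheory

noncomputable section

/-- The lattice `ℤ^d`. -/
abbrev ZLat (d : ℕ) := Fin d → ℤ

/-- A disorder configuration `ω ∈ {0,1}^{ℤ^d}` (`true` = bad site). -/
abbrev DConf (d : ℕ) := ZLat d → Bool

/-- The `ℓ¹` distance on `ℤ^d`. -/
def D1 {d : ℕ} (x y : ZLat d) : ℕ := ∑ i, (x i - y i).natAbs

/-- The sup distance on `ℤ^d`. -/
def supD {d : ℕ} (x y : ZLat d) : ℕ := Finset.univ.sup fun i => (x i - y i).natAbs

/-- The `ℓ¹` ball `O_r(x)` of (real) radius `r` around `x`. -/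
def ball1 {d : ℕ} (x : ZLat d) (r : ℝ) : Set (ZLat d) := {y | (D1 x y : ℝ) ≤ r}

/-- The `ℓ¹` neighborhood `O_r(X)` of a set `X`. -/
def nbd1 {d : ℕ} (X : Set (ZLat d)) (r : ℝ) : Set (ZLat d) :=
  {y | ∃ x ∈ X, (D1 x y : ℝ) ≤ r}

/-- The σ-algebra `𝒜_Λ` generated by the coordinates in `Λ`. -/
def cylSigma {d : ℕ} (Λ : Set (ZLat d)) : MeasurableSpace (DConf d) :=
  MeasurableSpace.comap (fun ω => fun x : Λ => ω x) inferInstance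

/-- `f` is a local function with support contained in the finite set `S`. -/
def LocalOn {d : ℕ} (f : DConf d → ℝ) (S : Finset (ZLat d)) : Prop :=
  ∀ σ τ : DConf d, (∀ x ∈ S, σ x = τ x) → f σ = f τ

/-- Sup norm of a real valued function. -/
def supNorm {α : Type*} (f : α → ℝ) : ℝ := ⨆ a, |f a|

/-- The `ℓ¹` distance between two finite subsets of the lattice. -/
def fDist1 {d : ℕ} (A B : Finset (ZLat d)) : ℝ :=
  sInf ((fun p : ZLat d × ZLat d => (D1 p.1 p.2 : ℝ)) '' {p | p.1 ∈ A ∧ p.2 ∈ B})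

/-- The decay condition (smin): exponential decay of correlations of `Q`. -/
def Smin {d : ℕ} (Q : Measure (DConf d)) (b'' B'' : ℝ) : Prop :=
  ∀ (f g : DConf d → ℝ) (Sf Sg : Finset (ZLat d)),
    LocalOn f Sf → LocalOn g Sg →
    (min Sf.card Sg.card : ℝ) * Real.exp (-b'' * fDist1 Sf Sg) ≤ 1 →
    |(∫ ω, f ω * g ω ∂Q) - (∫ ω, f ω ∂Q) * ∫ ω, g ω ∂Q| ≤
      B'' * supNorm f * supNorm g * (min Sf.card Sg.card : ℝ) *
        Real.exp (-b'' * fDist1 Sf Sg)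

/-- `θ_j = ∑_{i=0}^{j} (Γ_i + γ_i)`. -/
def theta (Γ γ : ℕ → ℝ) (j : ℕ) : ℝ := ∑ i ∈ Finset.range (j + 1), (Γ i + γ i)

/-- Moderately steep scales, with parameters `a > 0` and `ε ∈ (0,1)`
(items (1)–(5) of the definition). -/
structure ModSteep (d : ℕ) (Γ γ : ℕ → ℝ) (a ε : ℝ) : Prop where
  gammaBigMono : StrictMono Γ
  gammaSmallMono : StrictMono γ
  gammaBigZero : Γ 0 = 0
  gammaSmallZero : 0 ≤ γ 0
  gammaBigOne : 2 ≤ Γ 1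
  halfLt : ∀ j : ℕ, 1 ≤ j → Γ j < γ j / 2
  lam : ∀ j : ℕ, 10 * theta Γ γ j ≤ Γ (j + 1)
  covolSummable : Summable (fun j : ℕ => if j = 0 then (0 : ℝ) else Γ j / γ j)
  covol : (∑' j : ℕ, if j = 0 then (0 : ℝ) else Γ j / γ j) ≤ 1 / 2
  apos : 0 < a
  epsMem : ε ∈ Set.Ioo (0 : ℝ) 1
  growth : ∀ k : ℕ, 2 * 3 ^ d * theta Γ γ (k + 1) ^ d ≤ Real.exp (a * (1 + ε) ^ k)
  tail : ∀ s : ℝ, 0 ≤ s → ∀ q : ℝ, 1 < q →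
    Summable fun k : ℕ => theta Γ γ k ^ s * Real.exp (-a * (1 + ε) ^ k / q)

/-- `x` is a gentle point at level `k ≥ 1` with respect to the set `Bprev` of
`(k-1)`-bad points: `x ∈ Bprev`, the atom `A = O_{Γ_k}(x) ∩ Bprev` has `ℓ¹` diameter
at most `Γ_k`, and `D(A, Bprev ∖ A) > γ_k`. -/
def gentleOn {d : ℕ} (Γ γ : ℕ → ℝ) (Bprev : Set (ZLat d)) (k : ℕ) (x : ZLat d) : Prop :=
  x ∈ Bprev ∧
  (∀ u ∈ ball1 x (Γ k) ∩ Bprev, ∀ v ∈ ball1 x (Γ k) ∩ Bprev, (D1 u v : ℝ) ≤ Γ k) ∧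
  (∀ u ∈ ball1 x (Γ k) ∩ Bprev, ∀ v ∈ Bprev \ (ball1 x (Γ k) ∩ Bprev),
    γ k < (D1 u v : ℝ))

/-- The recursive classification of badness: `B_0(ω) = {x : ω_x = 1}` and
`B_k(ω) = B_{k-1}(ω)` minus the `k`-gentle points. -/
def badSet {d : ℕ} (Γ γ : ℕ → ℝ) (ω : DConf d) : ℕ → Set (ZLat d)
  | 0 => {x | ω x = true}
  | k + 1 => {x | x ∈ badSet Γ γ ω k ∧ ¬ gentleOn Γ γ (badSet Γ γ ω k) (k + 1) x}

/-- The `k`-gentle sites: `G_0(ω) = {x : ω_x = 0}`, `G_k(ω) = B_{k-1}(ω) ∖ B_k(ω)`. -/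
def gentleSet {d : ℕ} (Γ γ : ℕ → ℝ) (ω : DConf d) : ℕ → Set (ZLat d)
  | 0 => {x | ω x = false}
  | k + 1 => badSet Γ γ ω k \ badSet Γ γ ω (k + 1)

/-- The collection of `k`-gentle atoms `𝒢_k(ω)` (for `k ≥ 1`):
`A = O_{Γ_k}(x) ∩ B_{k-1}(ω)` for `x` a `k`-gentle point. -/
def atomsAt {d : ℕ} (Γ γ : ℕ → ℝ) (ω : DConf d) (k : ℕ) : Set (Set (ZLat d)) :=
  {A | ∃ x : ZLat d, gentleOn Γ γ (badSet Γ γ ω (k - 1)) k x ∧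
        A = ball1 x (Γ k) ∩ badSet Γ γ ω (k - 1)}

/-- The smallest coordinate parallelepiped `Env(g)` containing `g`. -/
def env {d : ℕ} (g : Set (ZLat d)) : Set (ZLat d) :=
  {x | ∀ i : Fin d, (∃ u ∈ g, u i ≤ x i) ∧ ∃ v ∈ g, x i ≤ v i}

/-- The residual bad sets of a graded family of atoms:
`B_0 = 𝕃 ∖ G_0`, `B_j = B_{j-1} ∖ ⋃(atoms of grade j)`. -/
def Bres {d : ℕ} (G0 : Set (ZLat d)) (atoms : ℕ → Set (Set (ZLat d))) : ℕ → Set (ZLat d)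
  | 0 => G0ᶜ
  | k + 1 => Bres G0 atoms k \ ⋃ g ∈ atoms (k + 1), g

/-- A gentle disintegration of `ℤ^d` with respect to `G0` and the scales `Γ, γ`. -/
structure GentleDisintegration (d : ℕ) (G0 : Set (ZLat d)) (Γ γ : ℕ → ℝ) where
  atoms : ℕ → Set (Set (ZLat d))
  atomFinite : ∀ j, ∀ g ∈ atoms j, g.Finite
  atomNonempty : ∀ j, ∀ g ∈ atoms j, g.Nonempty
  uniqueGrade : ∀ j j' g, g ∈ atoms j → g ∈ atoms j' → j = j'
  pairwiseDisjoint : ∀ j j' g g', g ∈ atoms j → g' ∈ atoms j' → g ≠ g' → Disjoint g g'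
  cover : ∀ x : ZLat d, ∃ j, ∃ g ∈ atoms j, x ∈ g
  grade0 : atoms 0 = {s | ∃ x ∈ G0, s = {x}}
  subsBad : ∀ j, ∀ g ∈ atoms (j + 1), g ⊆ Bres G0 atoms j
  diamBound : ∀ j, 1 ≤ j → ∀ g ∈ atoms j, ∀ u ∈ g, ∀ v ∈ g, (D1 u v : ℝ) ≤ Γ j
  separation : ∀ j, ∀ g ∈ atoms (j + 1), ∀ u ∈ g, ∀ v ∈ Bres G0 atoms j \ g,
    γ (j + 1) < (D1 u v : ℝ)
  horizon : ∀ x : ZLat d,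
    {j : ℕ | 1 ≤ j ∧ ∃ g ∈ atoms j, ∃ y ∈ env g, (supD x y : ℝ) ≤ theta Γ γ j}.Finite


theorem D1_comm {d : ℕ} (x y : ZLat d) : D1 x y = D1 y x := by
  unfold D1
  exact Finset.sum_congr rfl fun i _ => by omega

theorem D1_self {d : ℕ} (x : ZLat d) : D1 x x = 0 := by simp [D1]

theorem D1_triangle {d : ℕ} (x y z : ZLat d) : D1 x z ≤ D1 x y + D1 y z := by
  unfold D1
  rw [← Finset.sum_add_distrib]
  exact Finset.sum_le_sum fun i _ => by omega

theorem D1_triangle_real {d : ℕ} (x y z : ZLat d) :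
    (D1 x z : ℝ) ≤ D1 x y + D1 y z := by
  exact_mod_cast D1_triangle x y z

/-- The `ℓ¹` ball of radius `r` as a finite set. -/
def ballFinset {d : ℕ} (x : ZLat d) (r : ℝ) : Finset (ZLat d) := by
  classical
  exact (Fintype.piFinset fun i => Finset.Icc (x i - (⌊r⌋₊ : ℤ)) (x i + (⌊r⌋₊ : ℤ))).filter
    fun y => (D1 x y : ℝ) ≤ r

theorem mem_ballFinset {d : ℕ} {x y : ZLat d} {r : ℝ} :
    y ∈ ballFinset x r ↔ (D1 x y : ℝ) ≤ r := by
  classical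
  simp only [ballFinset, Finset.mem_filter, Fintype.mem_piFinset, Finset.mem_Icc,
    and_iff_right_iff_imp]
  intro h i
  have h1 : D1 x y ≤ ⌊r⌋₊ := Nat.le_floor h
  have h2 : (x i - y i).natAbs ≤ D1 x y :=
    Finset.single_le_sum (f := fun i => (x i - y i).natAbs) (fun _ _ => Nat.zero_le _)
      (Finset.mem_univ i)
  omega

theorem card_ballFinset_le {d : ℕ} (x : ZLat d) {r : ℝ} (hr : 1 ≤ r) :
    ((ballFinset x r).card : ℝ) ≤ 3 ^ d * r ^ d := by
  classical
  have h1 : (ballFinset x r).card ≤ (2 * ⌊r⌋₊ + 1) ^ d := by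
    refine (Finset.card_filter_le _ _).trans ?_
    rw [Fintype.card_piFinset]
    have h : ∀ i : Fin d,
        (Finset.Icc (x i - (⌊r⌋₊ : ℤ)) (x i + (⌊r⌋₊ : ℤ))).card = 2 * ⌊r⌋₊ + 1 := by
      intro i
      rw [Int.card_Icc]
      omega
    simp [h]
  have h2 : (⌊r⌋₊ : ℝ) ≤ r := Nat.floor_le (by linarith)
  calc ((ballFinset x r).card : ℝ) ≤ (2 * (⌊r⌋₊ : ℝ) + 1) ^ d := by exact_mod_cast h1
    _ ≤ (3 * r) ^ d := by gcongr; linarith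
    _ = 3 ^ d * r ^ d := mul_pow _ _ _

theorem gentleOn_of_agree {d : ℕ} {Γ γ : ℕ → ℝ} {B B' : Set (ZLat d)} {k : ℕ} {x : ZLat d}
    (hΓ : 0 ≤ Γ k) (hγ : 0 ≤ γ k)
    (h : ∀ y, (D1 x y : ℝ) ≤ Γ k + γ k → (y ∈ B ↔ y ∈ B')) (hg : gentleOn Γ γ B k x) :
    gentleOn Γ γ B' k x := by
  obtain ⟨hx, hdiam, hsep⟩ := hg
  have key : ∀ u, u ∈ ball1 x (Γ k) ∩ B' → u ∈ ball1 x (Γ k) ∩ B := by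
    rintro u ⟨hu, hu'⟩
    have hu1 : (D1 x u : ℝ) ≤ Γ k := hu
    exact ⟨hu, (h u (by linarith)).2 hu'⟩
  refine ⟨(h x (by rw [D1_self]; push_cast; linarith)).1 hx,
    fun u hu v hv => hdiam u (key u hu) v (key v hv), ?_⟩
  rintro u hu v ⟨hv, hv'⟩
  by_contra! hlt
  have hu1 : (D1 x u : ℝ) ≤ Γ k := hu.1
  have hvB : v ∈ B := (h v (by linarith [D1_triangle_real x u v])).2 hv
  exact absurd (hsep u (key u hu) v ⟨hvB, fun hc => hv' ⟨hc.1, hv⟩⟩) (not_lt.2 hlt)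

theorem exists_bad_of_not_gentleOn {d : ℕ} {Γ γ : ℕ → ℝ} {B : Set (ZLat d)} {k : ℕ}
    {x : ZLat d} (hΓ : 0 < Γ k) (hγ : 0 ≤ γ k) (hx : x ∈ B) (hg : ¬ gentleOn Γ γ B k x) :
    ∃ y ∈ B, Γ k / 2 < (D1 x y : ℝ) ∧ (D1 x y : ℝ) ≤ Γ k + γ k := by
  by_contra! hno
  refine hg ⟨hx, ?_, ?_⟩
  · have near : ∀ u ∈ ball1 x (Γ k) ∩ B, (D1 x u : ℝ) ≤ Γ k / 2 := by
      rintro u ⟨hu, huB⟩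
      have hu1 : (D1 x u : ℝ) ≤ Γ k := hu
      by_contra! hlt
      linarith [hno u huB hlt]
    intro u hu v hv
    have := D1_triangle_real u x v
    rw [D1_comm u x] at this
    linarith [near u hu, near v hv]
  · rintro u ⟨hu, huB⟩ v ⟨hv, hv'⟩
    have hu1 : (D1 x u : ℝ) ≤ Γ k := hu
    have hv1 : Γ k < (D1 x v : ℝ) := by
      by_contra! hle
      exact hv' ⟨hle, hv⟩
    linarith [hno v hv (by linarith), D1_triangle_real x u v]

namespace ModSteep

variable {d : ℕ} {Γ γ : ℕ → ℝ} {a ε : ℝ}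

theorem bigNonneg (hs : ModSteep d Γ γ a ε) (k : ℕ) : 0 ≤ Γ k := by
  rw [← hs.gammaBigZero]
  exact hs.gammaBigMono.monotone (Nat.zero_le k)

theorem smallNonneg (hs : ModSteep d Γ γ a ε) (k : ℕ) : 0 ≤ γ k :=
  hs.gammaSmallZero.trans (hs.gammaSmallMono.monotone (Nat.zero_le k))

theorem two_le_big (hs : ModSteep d Γ γ a ε) (k : ℕ) : 2 ≤ Γ (k + 1) :=
  hs.gammaBigOne.trans (hs.gammaBigMono.monotone (by omega))

theorem theta_nonneg (hs : ModSteep d Γ γ a ε) (k : ℕ) : 0 ≤ theta Γ γ k :=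
  Finset.sum_nonneg fun i _ => add_nonneg (hs.bigNonneg i) (hs.smallNonneg i)

end ModSteep

theorem theta_succ (Γ γ : ℕ → ℝ) (k : ℕ) :
    theta Γ γ (k + 1) = theta Γ γ k + (Γ (k + 1) + γ (k + 1)) :=
  Finset.sum_range_succ _ _

theorem ModSteep.one_le_theta {d : ℕ} {Γ γ : ℕ → ℝ} {a ε : ℝ} (hs : ModSteep d Γ γ a ε)
    (k : ℕ) : 1 ≤ theta Γ γ (k + 1) := by
  rw [theta_succ]
  linarith [hs.theta_nonneg k, hs.two_le_big k, hs.smallNonneg (k + 1)]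

theorem badSet_congr {d : ℕ} {Γ γ : ℕ → ℝ} {a ε : ℝ} (hs : ModSteep d Γ γ a ε) (k : ℕ)
    (x : ZLat d) (σ τ : DConf d) (h : ∀ y ∈ ballFinset x (theta Γ γ k), σ y = τ y) :
    x ∈ badSet Γ γ σ k ↔ x ∈ badSet Γ γ τ k := by
  induction k generalizing x with
  | zero =>
    have hx : σ x = τ x := h x (by
      rw [mem_ballFinset, D1_self]
      exact_mod_cast hs.theta_nonneg 0)
    simp [badSet, hx]
  | succ k ih =>
    have hΓ := hs.bigNonneg (k + 1)
    have hγ := hs.smallNonneg (k + 1)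
    have agree : ∀ z, (D1 x z : ℝ) ≤ Γ (k + 1) + γ (k + 1) →
        (z ∈ badSet Γ γ σ k ↔ z ∈ badSet Γ γ τ k) := by
      intro z hz
      refine ih z fun y hy => h y ?_
      rw [mem_ballFinset] at hy ⊢
      rw [theta_succ]
      linarith [D1_triangle_real x z y]
    have hx := agree x (by rw [D1_self]; push_cast; linarith)
    have hg : gentleOn Γ γ (badSet Γ γ σ k) (k + 1) x ↔
        gentleOn Γ γ (badSet Γ γ τ k) (k + 1) x :=
      ⟨gentleOn_of_agree hΓ hγ agree,
        gentleOn_of_agree hΓ hγ fun y hy => (agree y hy).symm⟩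
    simp only [badSet, Set.mem_ofPred_eq, hx, hg]

theorem subset_badSet_zero {d : ℕ} (Γ γ : ℕ → ℝ) (ω : DConf d) (k : ℕ) :
    badSet Γ γ ω k ⊆ {x | ω x = true} := by
  induction k with
  | zero => exact subset_rfl
  | succ k ih => exact fun x hx => ih hx.1

theorem measurableSet_of_local {d : ℕ} (E : Set (DConf d)) (S : Finset (ZLat d))
    (h : ∀ σ τ : DConf d, (∀ x ∈ S, σ x = τ x) → (σ ∈ E ↔ τ ∈ E)) : MeasurableSet E := by
  have hE : E = (fun (ω : DConf d) (x : S) => ω x) ⁻¹'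
      ((fun (ω : DConf d) (x : S) => ω x) '' E) := by
    ext ω
    refine ⟨fun hω => ⟨ω, hω, rfl⟩, ?_⟩
    rintro ⟨σ, hσ, heq⟩
    exact (h σ ω fun x hx => congrFun heq ⟨x, hx⟩).1 hσ
  rw [hE]
  exact (measurable_pi_lambda _ fun x => measurable_pi_apply _)
    (Set.toFinite _).measurableSet

/-- The decay condition for indicators of local events. -/
theorem Smin.measureReal_inter {d : ℕ} {Q : Measure (DConf d)} [IsProbabilityMeasure Q]
    {b'' B'' : ℝ} (hB : 0 < B'') (hQ : Smin Q b'' B'') (E F : Set (DConf d))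
    (S T : Finset (ZLat d))
    (hE : ∀ σ τ : DConf d, (∀ x ∈ S, σ x = τ x) → (σ ∈ E ↔ τ ∈ E))
    (hF : ∀ σ τ : DConf d, (∀ x ∈ T, σ x = τ x) → (σ ∈ F ↔ τ ∈ F))
    (hST : (min S.card T.card : ℝ) * Real.exp (-b'' * fDist1 S T) ≤ 1) :
    |Q.real (E ∩ F) - Q.real E * Q.real F| ≤
      B'' * ((min S.card T.card : ℝ) * Real.exp (-b'' * fDist1 S T)) := by
  have hEm := measurableSet_of_local E S hE
  have hFm := measurableSet_of_local F T hF
  have hloc : ∀ (A : Set (DConf d)) (U : Finset (ZLat d)),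
      (∀ σ τ : DConf d, (∀ x ∈ U, σ x = τ x) → (σ ∈ A ↔ τ ∈ A)) →
      LocalOn (A.indicator (1 : DConf d → ℝ)) U := by
    intro A U hA σ τ hστ
    classical
    simp only [Set.indicator_apply, hA σ τ hστ, Pi.one_apply]
  have hsup0 : ∀ A : Set (DConf d), 0 ≤ supNorm (A.indicator (1 : DConf d → ℝ)) :=
    fun A => Real.iSup_nonneg fun _ => abs_nonneg _
  have hsup1 : ∀ A : Set (DConf d), supNorm (A.indicator (1 : DConf d → ℝ)) ≤ 1 := by
    intro A
    refine Real.iSup_le (fun ω => ?_) zero_le_one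
    by_cases hω : ω ∈ A <;> simp [hω]
  have key := hQ _ _ S T (hloc E S hE) (hloc F T hF) hST
  have hmul : (fun ω => E.indicator (1 : DConf d → ℝ) ω * F.indicator (1 : DConf d → ℝ) ω) =
      (E ∩ F).indicator 1 := by
    rw [Set.inter_indicator_one]
    rfl
  rw [hmul, integral_indicator_one (hEm.inter hFm), integral_indicator_one hEm,
    integral_indicator_one hFm] at key
  refine key.trans ?_
  have hnn : 0 ≤ (min S.card T.card : ℝ) * Real.exp (-b'' * fDist1 S T) := by positivity
  have h1 : supNorm (E.indicator (1 : DConf d → ℝ)) * supNorm (F.indicator (1 : DConf d → ℝ)) ≤ 1 :=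
    mul_le_one₀ (hsup1 E) (hsup0 F) (hsup1 F)
  calc _ = B'' * ((supNorm (E.indicator (1 : DConf d → ℝ)) *
        supNorm (F.indicator (1 : DConf d → ℝ))) *
        ((min S.card T.card : ℝ) * Real.exp (-b'' * fDist1 S T))) := by ring
    _ ≤ B'' * (1 * ((min S.card T.card : ℝ) * Real.exp (-b'' * fDist1 S T))) := by gcongr
    _ = _ := by rw [one_mul]

/-- The decay condition bounds the variance of a single occupation variable. -/
theorem Smin.variance_le {d : ℕ} {Q : Measure (DConf d)} [IsProbabilityMeasure Q]
    {b'' B'' : ℝ} (hB : 0 < B'') (hQ : Smin Q b'' B'') (x : ZLat d) :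
    Q.real {ω | ω x = true} * (1 - Q.real {ω | ω x = true}) ≤ B'' := by
  have hloc : ∀ σ τ : DConf d, (∀ y ∈ ({x} : Finset (ZLat d)), σ y = τ y) →
      (σ ∈ {ω : DConf d | ω x = true} ↔ τ ∈ {ω : DConf d | ω x = true}) := by
    intro σ τ h
    simp [h x (Finset.mem_singleton_self x)]
  have hdist : fDist1 ({x} : Finset (ZLat d)) {x} = 0 := by
    have : {p : ZLat d × ZLat d | p.1 ∈ ({x} : Finset (ZLat d)) ∧
        p.2 ∈ ({x} : Finset (ZLat d))} = {(x, x)} := by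
      ext ⟨u, v⟩
      simp
    rw [fDist1, this, Set.image_singleton, csInf_singleton]
    simp [D1_self]
  have h := hQ.measureReal_inter hB _ _ {x} {x} hloc hloc (by simp [hdist])
  simp only [hdist, Set.inter_self, Finset.card_singleton, Nat.cast_one, min_self, mul_zero,
    Real.exp_zero, mul_one] at h
  linarith [(abs_le.1 h).2]

theorem sub_le_fDist1_ballFinset {d : ℕ} (x y : ZLat d) {r : ℝ} (hr : 0 ≤ r) :
    (D1 x y : ℝ) - 2 * r ≤ fDist1 (ballFinset x r) (ballFinset y r) := by
  have hself : ∀ z : ZLat d, z ∈ ballFinset z r := fun z => by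
    rw [mem_ballFinset, D1_self]
    exact_mod_cast hr
  refine le_csInf ⟨_, (x, y), ⟨hself x, hself y⟩, rfl⟩ ?_
  rintro _ ⟨⟨u, v⟩, ⟨hu, hv⟩, rfl⟩
  simp only [mem_ballFinset] at hu hv
  have h1 := D1_triangle_real x u y
  have h2 := D1_triangle_real u v y
  rw [D1_comm v y] at h2
  simp only
  linarith

/-- Two-point bound for `k`-badness of well separated sites. -/
theorem measureReal_bad_inter_le {d : ℕ} {Γ γ : ℕ → ℝ} {a ε : ℝ} (hs : ModSteep d Γ γ a ε)
    {Q : Measure (DConf d)} [IsProbabilityMeasure Q] {b'' B'' : ℝ} (hb : 0 < b'')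
    (hB : 0 < B'') (hQ : Smin Q b'' B'') (k : ℕ) (x y : ZLat d)
    (hxy : Γ (k + 1) / 2 < (D1 x y : ℝ))
    (hsmall : 3 ^ d * theta Γ γ (k + 1) ^ d * Real.exp (-b'' * Γ (k + 1) / 20) ≤ 1) :
    Q.real ({ω | x ∈ badSet Γ γ ω k} ∩ {ω | y ∈ badSet Γ γ ω k}) ≤
      Q.real {ω | x ∈ badSet Γ γ ω k} * Q.real {ω | y ∈ badSet Γ γ ω k} +
        B'' * (3 ^ d * theta Γ γ (k + 1) ^ d * Real.exp (-b'' * Γ (k + 1) / 20)) := by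
  have hθ := hs.theta_nonneg k
  have hΓ := hs.two_le_big k
  have hθ' : theta Γ γ k ≤ theta Γ γ (k + 1) := by
    rw [theta_succ]
    linarith [hs.smallNonneg (k + 1)]
  have hcard : ((ballFinset x (theta Γ γ k)).card : ℝ) ≤ 3 ^ d * theta Γ γ (k + 1) ^ d := by
    refine le_trans ?_ (card_ballFinset_le x (hs.one_le_theta k))
    refine Nat.cast_le.2 (Finset.card_le_card fun z hz => ?_)
    rw [mem_ballFinset] at hz ⊢
    exact hz.trans hθ'
  have hdist : Γ (k + 1) / 20 ≤
      fDist1 (ballFinset x (theta Γ γ k)) (ballFinset y (theta Γ γ k)) := by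
    linarith [sub_le_fDist1_ballFinset x y hθ, hs.lam k]
  have hexp : (min (ballFinset x (theta Γ γ k)).card (ballFinset y (theta Γ γ k)).card : ℝ) *
      Real.exp (-b'' * fDist1 (ballFinset x (theta Γ γ k)) (ballFinset y (theta Γ γ k))) ≤
      3 ^ d * theta Γ γ (k + 1) ^ d * Real.exp (-b'' * Γ (k + 1) / 20) := by
    refine mul_le_mul ((min_le_left _ _).trans hcard) (Real.exp_le_exp.2 ?_)
      (Real.exp_pos _).le ((Nat.cast_nonneg _).trans hcard)
    have := mul_le_mul_of_nonneg_left hdist hb.le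
    linarith
  have h := hQ.measureReal_inter hB {ω | x ∈ badSet Γ γ ω k} {ω | y ∈ badSet Γ γ ω k} _ _
    (badSet_congr hs k x) (badSet_congr hs k y) (hexp.trans hsmall)
  have := mul_le_mul_of_nonneg_left hexp hB.le
  linarith [(abs_le.1 h).2]

/-- A union bound for the recursion step of badness. -/
theorem measureReal_bad_succ_le {d : ℕ} {Γ γ : ℕ → ℝ} {a ε : ℝ} (hs : ModSteep d Γ γ a ε)
    {Q : Measure (DConf d)} [IsProbabilityMeasure Q] (k : ℕ) (x : ZLat d) {c : ℝ} (hc : 0 ≤ c)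
    (h : ∀ y, Γ (k + 1) / 2 < (D1 x y : ℝ) →
      Q.real ({ω | x ∈ badSet Γ γ ω k} ∩ {ω | y ∈ badSet Γ γ ω k}) ≤ c) :
    Q.real {ω | x ∈ badSet Γ γ ω (k + 1)} ≤ 3 ^ d * theta Γ γ (k + 1) ^ d * c := by
  classical
  set T := (ballFinset x (theta Γ γ (k + 1))).filter
    fun y => Γ (k + 1) / 2 < (D1 x y : ℝ) with hT
  have hsub : {ω | x ∈ badSet Γ γ ω (k + 1)} ⊆
      ⋃ y ∈ T, {ω | x ∈ badSet Γ γ ω k} ∩ {ω | y ∈ badSet Γ γ ω k} := by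
    rintro ω ⟨hx, hg⟩
    obtain ⟨y, hy, hlt, hle⟩ := exists_bad_of_not_gentleOn
      (by linarith [hs.two_le_big k]) (hs.smallNonneg (k + 1)) hx hg
    refine Set.mem_biUnion (x := y) ?_ ⟨hx, hy⟩
    rw [hT, Finset.mem_coe, Finset.mem_filter, mem_ballFinset, theta_succ]
    exact ⟨by linarith [hs.theta_nonneg k], hlt⟩
  have hcard : (T.card : ℝ) ≤ 3 ^ d * theta Γ γ (k + 1) ^ d :=
    le_trans (Nat.cast_le.2 (Finset.card_filter_le _ _))
      (card_ballFinset_le x (hs.one_le_theta k))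
  calc Q.real {ω | x ∈ badSet Γ γ ω (k + 1)}
      ≤ Q.real (⋃ y ∈ T, {ω | x ∈ badSet Γ γ ω k} ∩ {ω | y ∈ badSet Γ γ ω k}) :=
        measureReal_mono hsub (measure_ne_top _ _)
    _ ≤ ∑ y ∈ T, Q.real ({ω | x ∈ badSet Γ γ ω k} ∩ {ω | y ∈ badSet Γ γ ω k}) :=
        measureReal_biUnion_finset_le _ _
    _ ≤ T.card • c := Finset.sum_le_card_nsmul _ _ _ fun y hy => h y (Finset.mem_filter.1 hy).2
    _ = T.card * c := nsmul_eq_mul _ _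
    _ ≤ _ := by gcongr

theorem ModSteep.exp_neg_le_half {d : ℕ} {Γ γ : ℕ → ℝ} {a ε : ℝ} (hs : ModSteep d Γ γ a ε) :
    Real.exp (-a / (1 - ε)) ≤ 1 / 2 := by
  obtain ⟨hε0, hε1⟩ := hs.epsMem
  have h1 : 2 ≤ Real.exp a := by
    have h := hs.growth 0
    rw [pow_zero, mul_one, mul_assoc] at h
    have h3 : (1 : ℝ) ≤ 3 ^ d * theta Γ γ (0 + 1) ^ d :=
      one_le_mul_of_one_le_of_one_le (one_le_pow₀ (by norm_num))
        (one_le_pow₀ (hs.one_le_theta 0))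
    linarith
  have h2 : -a / (1 - ε) ≤ -a := by
    rw [div_le_iff₀ (by linarith)]
    nlinarith [hs.apos]
  calc Real.exp (-a / (1 - ε)) ≤ Real.exp (-a) := Real.exp_le_exp.2 h2
    _ = 1 / Real.exp a := by rw [Real.exp_neg, one_div]
    _ ≤ 1 / 2 := one_div_le_one_div_of_le (by norm_num) h1

theorem ModSteep.growth_step {d : ℕ} {Γ γ : ℕ → ℝ} {a ε : ℝ} (hs : ModSteep d Γ γ a ε)
    (k : ℕ) :
    2 * 3 ^ d * theta Γ γ (k + 1) ^ d *
        (Real.exp (-(a / (1 - ε)) * (1 + ε) ^ k) * Real.exp (-(a / (1 - ε)) * (1 + ε) ^ k)) ≤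
      Real.exp (-(a / (1 - ε)) * (1 + ε) ^ (k + 1)) := by
  have hne : (1 : ℝ) - ε ≠ 0 := by linarith [hs.epsMem.2]
  refine (mul_le_mul_of_nonneg_right (hs.growth k) (by positivity)).trans (le_of_eq ?_)
  rw [← Real.exp_add, ← Real.exp_add]
  congr 1
  rw [pow_succ]
  field_simp
  ring

/-- Exponential bound on the probability of `k`-badness. Under the
hypotheses of the gentle-disintegration theorem,
`sup_x Q(x ∈ B_k) ≤ exp(−(a/(1−ε))(1+ε)^k)` for every `k ≥ 0`. -/
theorem stmt5 {d : ℕ} (Γ γ : ℕ → ℝ) (a ε : ℝ) (hs : ModSteep d Γ γ a ε)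
    (Q : Measure (DConf d)) [IsProbabilityMeasure Q]
    (b'' B'' : ℝ) (hb : 0 < b'') (hB : 0 < B'') (hQ : Smin Q b'' B'')
    (hp : ∀ x : ZLat d,
      Q {ω | ω x = true} ≤ ENNReal.ofReal (Real.exp (-a / (1 - ε))))
    (hgag : ∀ k : ℕ,
      2 * 9 ^ d * B'' * theta Γ γ (k + 1) ^ (2 * d) *
          Real.exp (-b'' * Γ (k + 1) / 20) ≤
        Real.exp (-(a / (1 - ε)) * (1 + ε) ^ (k + 1))) :
    ∀ (k : ℕ) (x : ZLat d),
      Q {ω | x ∈ badSet Γ γ ω k} ≤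
        ENNReal.ofReal (Real.exp (-(a / (1 - ε)) * (1 + ε) ^ k)) := by
  have hreal : ∀ (k : ℕ) (x : ZLat d), Q.real {ω | x ∈ badSet Γ γ ω k} ≤
      Real.exp (-(a / (1 - ε)) * (1 + ε) ^ k) := by
    intro k
    induction k with
    | zero =>
      intro x
      rw [pow_zero, mul_one, ← neg_div]
      exact ENNReal.toReal_le_of_le_ofReal (Real.exp_pos _).le (hp x)
    | succ k ih =>
      intro x
      set R := Real.exp (-(a / (1 - ε)) * (1 + ε) ^ (k + 1)) with hR
      set P := Q.real {ω : DConf d | ω x = true} with hP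
      have hmono : Q.real {ω | x ∈ badSet Γ γ ω (k + 1)} ≤ P :=
        measureReal_mono fun ω hω => subset_badSet_zero Γ γ ω (k + 1) hω
      rcases le_or_gt P R with hPR | hPR
      · exact hmono.trans hPR
      have hPhalf : P ≤ 1 / 2 :=
        (ENNReal.toReal_le_of_le_ofReal (Real.exp_pos _).le (hp x)).trans hs.exp_neg_le_half
      have hR0 : 0 < R := Real.exp_pos _
      have hRB : R ≤ 2 * B'' := by
        have hvar : P * (1 - P) ≤ B'' := hQ.variance_le hB x
        nlinarith
      set N := (3 : ℝ) ^ d * theta Γ γ (k + 1) ^ d with hN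
      set e := Real.exp (-b'' * Γ (k + 1) / 20) with he
      have he0 : 0 < e := Real.exp_pos _
      have hN1 : 1 ≤ N := one_le_mul_of_one_le_of_one_le (one_le_pow₀ (by norm_num))
        (one_le_pow₀ (hs.one_le_theta k))
      have hgag' : 2 * (N * (B'' * (N * e))) ≤ R := by
        refine (le_of_eq ?_).trans (hgag k)
        rw [hN, show (9 : ℝ) = 3 * 3 by norm_num, mul_pow, two_mul d, pow_add]
        ring
      have hsmall : N * e ≤ 1 := by
        have h1 : B'' * (N * (N * e)) ≤ B'' * 1 := by linarith
        have h2 := le_of_mul_le_mul_left h1 hB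
        nlinarith [mul_pos (by linarith : 0 < N) he0]
      set q := Real.exp (-(a / (1 - ε)) * (1 + ε) ^ k) with hq
      have hgrow : 2 * N * (q * q) ≤ R := by
        refine (le_of_eq ?_).trans (hs.growth_step k)
        rw [hN]
        ring
      have hstep := measureReal_bad_succ_le hs (Q := Q) k x (c := q * q + B'' * (N * e))
        (by positivity) fun y hy =>
          (measureReal_bad_inter_le hs hb hB hQ k x y hy hsmall).trans
            (add_le_add_left (mul_le_mul (ih x) (ih y) measureReal_nonneg
              (Real.exp_pos _).le) _)
      linarith
  intro k x
  rw [← ofReal_measureReal]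
  exact ENNReal.ofReal_le_ofReal (hreal k x)

end

end Paper
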